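/- Let m ≤ n and regard F_m ⊆ F_n via inclusion of generators. There exists an automorphism of F_m inverting a word w ∈ F_m if and only if there exists an automorphism of F_n inverting w. -/

import Mathlib

def freeIncl {m n : ℕ} (h : m ≤ n) : FreeGroup (Fin m) →* FreeGroup (Fin n) :=
  FreeGroup.lift fun i => FreeGroup.of (Fin.castLE h i)

section FreeFactor

universe u

open FreeGroup

variable {β : Type u}

lemma QuotientGroup.coe_mul_eq_smul {G : Type*} [Group G] {H : Subgroup G} (x y : G) :
    ((x * y : G) : G ⧸ H) = x • (y : G ⧸ H) :=
  rfl

lemma FreeGroup.exists_mk_eq_of_mem_closure_of_image {S : Set β} {g : FreeGroup β}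
    (hg : g ∈ Subgroup.closure (of '' S)) :
    ∃ l : List (β × Bool), (∀ x ∈ l, x.1 ∈ S) ∧ mk l = g := by
  induction hg using Subgroup.closure_induction with
  | mem x hx =>
    obtain ⟨a, ha, rfl⟩ := hx
    exact ⟨[(a, true)], by simpa using ha, rfl⟩
  | one => exact ⟨[], by simp, rfl⟩
  | mul x y _ _ hx hy =>
    obtain ⟨l, hl, rfl⟩ := hx
    obtain ⟨l', hl', rfl⟩ := hy
    refine ⟨l ++ l', fun x hx => ?_, mul_mk.symm⟩
    rcases List.mem_append.1 hx with h | h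
    exacts [hl x h, hl' x h]
  | inv x _ hx =>
    obtain ⟨l, hl, rfl⟩ := hx
    refine ⟨invRev l, fun x hx => ?_, inv_mk.symm⟩
    simp only [invRev, List.mem_reverse, List.mem_map] at hx
    obtain ⟨y, hy, rfl⟩ := hx
    exact hl y hy

lemma FreeGroup.mk_mem_closure_of_image {S : Set β} {l : List (β × Bool)}
    (hl : ∀ x ∈ l, x.1 ∈ S) : mk l ∈ Subgroup.closure (of '' S) := by
  induction l with
  | nil => exact one_mem _
  | cons x l ih =>
    rw [← List.singleton_append, ← mul_mk]
    refine mul_mem ?_ (ih fun y hy => hl y (List.mem_cons_of_mem _ hy))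
    have hx : of x.1 ∈ Subgroup.closure (of '' S) :=
      Subgroup.subset_closure ⟨x.1, hl x List.mem_cons_self, rfl⟩
    obtain ⟨a, _ | _⟩ := x
    · exact inv_mem hx
    · exact hx

/-- Words ordered by their number of letters outside `S`, ties being broken by a shortlex order. -/
def WordLT (S : Set β) : List (β × Bool) → List (β × Bool) → Prop :=
  open Classical in
  InvImage (Prod.Lex (· < ·) (List.Shortlex WellOrderingRel))
    fun l => (l.countP fun x => x.1 ∉ S, l)

lemma WordLT.wf (S : Set β) : WellFounded (WordLT S) :=
  InvImage.wf _ (wellFounded_lt.prod_lex (List.Shortlex.wf WellOrderingRel.isWellOrder.wf))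

lemma WordLT.trichotomous (S : Set β) (l l' : List (β × Bool)) (h : ¬ WordLT S l l')
    (h' : ¬ WordLT S l' l) : l = l' := by
  simp only [WordLT, InvImage, Prod.lex_def, not_or, not_and] at h h'
  have hc := le_antisymm (not_lt.1 h'.1) (not_lt.1 h.1)
  exact Std.Trichotomous.trichotomous (r := List.Shortlex WellOrderingRel) l l' (h.2 hc)
    (h'.2 hc.symm)

lemma WordLT.cons {S : Set β} {l l' : List (β × Bool)} (h : WordLT S l l') (x : β × Bool) :
    WordLT S (x :: l) (x :: l') := by
  simp only [WordLT, InvImage, Prod.lex_def, List.countP_cons, List.shortlex_cons_iff] at h ⊢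
  simpa using h

/-- A Schreier transversal of `H`, chosen so that cosets meeting the subgroup generated by `S` are
represented by elements of that subgroup. The last clause expresses that the edges of the coset
graph along which `t` is compatible with left multiplication connect the graph. -/
lemma FreeGroup.exists_schreier_transversal (H : Subgroup (FreeGroup β)) (S : Set β) :
    ∃ t : FreeGroup β ⧸ H → FreeGroup β,
      (∀ q, (t q : FreeGroup β ⧸ H) = q) ∧ t (1 : FreeGroup β) = 1 ∧
      (∀ g ∈ Subgroup.closure (of '' S), t (g : FreeGroup β) ∈ Subgroup.closure (of '' S)) ∧
      ∀ P : FreeGroup β ⧸ H → Prop, P (1 : FreeGroup β) →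
        (∀ q a, t (of a • q) = of a * t q → (P q ↔ P (of a • q))) → ∀ q, P q := by
  classical
  have hne (q : FreeGroup β ⧸ H) :
      {l : List (β × Bool) | ((mk l : FreeGroup β) : FreeGroup β ⧸ H) = q}.Nonempty := by
    obtain ⟨g, rfl⟩ := QuotientGroup.mk_surjective q
    exact ⟨g.toWord, by simp [mk_toWord]⟩
  let ℓ : FreeGroup β ⧸ H → List (β × Bool) := fun q => (WordLT.wf S).min _ (hne q)
  have hℓ (q) : ((mk (ℓ q) : FreeGroup β) : FreeGroup β ⧸ H) = q := (WordLT.wf S).min_mem _ (hne q)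
  have hmin (q) (l : List (β × Bool)) (hl : ((mk l : FreeGroup β) : FreeGroup β ⧸ H) = q) :
      ¬ WordLT S l (ℓ q) := (WordLT.wf S).not_lt_min _ hl
  have hone : ℓ (1 : FreeGroup β) = [] := by
    have h := hmin (1 : FreeGroup β) [] rfl
    by_contra hn
    refine h ?_
    simp only [WordLT, InvImage, Prod.lex_def, List.countP_nil]
    rcases Nat.eq_zero_or_pos (List.countP (fun x => decide (x.1 ∉ S)) (ℓ (1 : FreeGroup β)))
      with h0 | h0
    · exact Or.inr ⟨h0.symm, (List.shortlex_nil_or_eq_nil _).resolve_right hn⟩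
    · exact Or.inl h0
  have htail (q) (x : β × Bool) (u) (h : ℓ q = x :: u) :
      ℓ ((mk u : FreeGroup β) : FreeGroup β ⧸ H) = u := by
    refine WordLT.trichotomous S _ _ (fun hlt => ?_) (hmin _ _ rfl)
    refine hmin q (x :: ℓ ((mk u : FreeGroup β) : FreeGroup β ⧸ H)) ?_ (h ▸ hlt.cons x)
    have hmul (v : List (β × Bool)) : ((mk (x :: v) : FreeGroup β) : FreeGroup β ⧸ H) =
        mk [x] • ((mk v : FreeGroup β) : FreeGroup β ⧸ H) := rfl
    rw [← hℓ q, h, hmul, hmul, hℓ]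
  refine ⟨fun q => mk (ℓ q), hℓ, congrArg mk hone, fun g hg => ?_, fun P h1 hstep => ?_⟩
  · obtain ⟨l, hl, rfl⟩ := exists_mk_eq_of_mem_closure_of_image hg
    refine mk_mem_closure_of_image fun x hx => ?_
    by_contra hxS
    refine hmin _ l rfl ?_
    simp only [WordLT, InvImage, Prod.lex_def]
    left
    rw [List.countP_eq_zero.2 (by simpa using fun a b h => hl (a, b) h), List.countP_pos_iff]
    exact ⟨x, hx, by simpa using hxS⟩
  · suffices ∀ l q, ℓ q = l → P q from fun q => this _ q rfl
    intro l
    induction l with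
    | nil =>
      intro q hq
      rw [← hℓ q, hq]
      exact h1
    | cons x u ih =>
      intro q hq
      have hu := htail q x u hq
      have hP := ih _ hu
      obtain ⟨a, _ | _⟩ := x
      · have hmk : mk (ℓ q) = (of a)⁻¹ * mk u := by
          rw [hq]; rfl
        have hq' : of a • q = ((mk u : FreeGroup β) : FreeGroup β ⧸ H) := by
          rw [← hℓ q, hmk, ← QuotientGroup.coe_mul_eq_smul, mul_inv_cancel_left]
        refine (hstep q a ?_).2 (hq' ▸ hP)
        simp only [hq', hu, hmk, mul_inv_cancel_left]
      · have hmk : mk (ℓ q) = of a * mk u := by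
          rw [hq]; rfl
        have hq' : of a • ((mk u : FreeGroup β) : FreeGroup β ⧸ H) = q := by
          rw [← hℓ q, hmk, ← QuotientGroup.coe_mul_eq_smul]
        rw [← hq']
        refine (hstep _ a ?_).1 hP
        simp only [hq', hu, hmk]

/-- The rewriting process of Reidemeister and Schreier. -/
lemma FreeGroup.mem_of_schreier_generators_mem {H : Subgroup (FreeGroup β)} {S : Set β}
    {t : FreeGroup β ⧸ H → FreeGroup β} (ht : t (1 : FreeGroup β) = 1)
    (W : Subgroup (FreeGroup β))
    (hW : ∀ a ∈ S, ∀ x ∈ Subgroup.closure (of '' S),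
      (t (of a • (x : FreeGroup β ⧸ H)))⁻¹ * of a * t x ∈ W)
    {g : FreeGroup β} (hg : g ∈ Subgroup.closure (of '' S)) (hgH : g ∈ H) : g ∈ W := by
  have key : ∀ x ∈ Subgroup.closure (of '' S),
      (t (g • (x : FreeGroup β ⧸ H)))⁻¹ * g * t x ∈ W := by
    clear hgH
    induction hg using Subgroup.closure_induction with
    | mem y hy =>
      obtain ⟨a, ha, rfl⟩ := hy
      exact hW a ha
    | one => simp
    | mul y z _ hz ihy ihz =>
      intro x hx
      have h := mul_mem (ihy (z * x) (mul_mem hz hx)) (ihz x hx)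
      rw [QuotientGroup.coe_mul_eq_smul, smul_smul] at h
      simpa [mul_assoc] using h
    | inv y hy ihy =>
      intro x hx
      have h := inv_mem (ihy (y⁻¹ * x) (mul_mem (inv_mem hy) hx))
      rw [QuotientGroup.coe_mul_eq_smul, smul_inv_smul] at h
      simpa [mul_assoc] using h
  have h := key 1 (one_mem _)
  have hq : g • ((1 : FreeGroup β) : FreeGroup β ⧸ H) = (1 : FreeGroup β) := by
    rw [← QuotientGroup.coe_mul_eq_smul, mul_one]
    exact QuotientGroup.eq.2 (by simpa using hgH)
  simpa [hq, ht] using h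

/-- A map `f` on the edges of the coset graph of `H` lets the free group act on `(G ⧸ H) × K`. -/
def FreeGroup.edgeAction (H : Subgroup (FreeGroup β)) {K : Type*} [Group K]
    (f : FreeGroup β ⧸ H → β → K) :
    FreeGroup β →* Equiv.Perm ((FreeGroup β ⧸ H) × K) :=
  lift fun a =>
    { toFun := fun p => (of a • p.1, f p.1 a * p.2)
      invFun := fun p => ((of a)⁻¹ • p.1, (f ((of a)⁻¹ • p.1) a)⁻¹ * p.2)
      left_inv := fun p => by simp
      right_inv := fun p => by simp }

section edgeAction

variable (H : Subgroup (FreeGroup β)) {K : Type*} [Group K] (f : FreeGroup β ⧸ H → β → K)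

lemma FreeGroup.edgeAction_of (a : β) (p : (FreeGroup β ⧸ H) × K) :
    edgeAction H f (of a) p = (of a • p.1, f p.1 a * p.2) := by
  simp [edgeAction]

lemma FreeGroup.edgeAction_apply (g : FreeGroup β) (q : FreeGroup β ⧸ H) (k : K) :
    edgeAction H f g (q, k) = (g • q, (edgeAction H f g (q, 1)).2 * k) := by
  induction g using FreeGroup.induction_on generalizing q k with
  | C1 => simp
  | of a => simp [edgeAction_of]
  | inv_of a ih =>
    have h (k' : K) : (edgeAction H f (of a)⁻¹) (q, k') =
        ((of a)⁻¹ • q, (f ((of a)⁻¹ • q) a)⁻¹ * k') := by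
      rw [_root_.map_inv, Equiv.Perm.inv_eq_iff_eq, edgeAction_of]
      simp
    rw [h, h]
    simp
  | mul x y hx hy =>
    have h (k' : K) : edgeAction H f (x * y) (q, k') = ((x * y) • q,
        (edgeAction H f x (y • q, 1)).2 * ((edgeAction H f y (q, 1)).2 * k')) := by
      rw [_root_.map_mul, Equiv.Perm.mul_apply, hy, hx, mul_smul]
    rw [h, h 1, mul_one, mul_assoc]

/-- The homomorphism on `H` obtained by multiplying the labels along closed paths. -/
def FreeGroup.edgeHom : H →* K where
  toFun h := (edgeAction H f h ((1 : FreeGroup β), 1)).2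
  map_one' := by simp
  map_mul' x y := by
    have hy : (y : FreeGroup β) • ((1 : FreeGroup β) : FreeGroup β ⧸ H) = (1 : FreeGroup β) := by
      rw [← QuotientGroup.coe_mul_eq_smul, mul_one]
      exact QuotientGroup.eq.2 (by simp)
    rw [Subgroup.coe_mul, _root_.map_mul, Equiv.Perm.mul_apply, edgeAction_apply H f y, hy,
      edgeAction_apply H f x]

end edgeAction

/-- A subgroup of a free group meets a standard free factor in a free factor of the subgroup. -/
theorem FreeGroup.exists_basis_closure_eq_subgroupOf (H : Subgroup (FreeGroup β)) (S : Set β) :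
    ∃ (ι : Type u) (b : FreeGroupBasis ι H) (J : Set ι),
      Subgroup.closure (b '' J) = (Subgroup.closure (of '' S)).subgroupOf H := by
  classical
  obtain ⟨t, htq, ht1, htS, htree⟩ := exists_schreier_transversal H S
  have hmem (q : FreeGroup β ⧸ H) (a : β) : (t (of a • q))⁻¹ * of a * t q ∈ H := by
    rw [mul_assoc, ← QuotientGroup.eq, htq, QuotientGroup.coe_mul_eq_smul, htq]
  let ι := {p : (FreeGroup β ⧸ H) × β // t (of p.2 • p.1) ≠ of p.2 * t p.1}
  let b : ι → H := fun p => ⟨_, hmem p.1.1 p.1.2⟩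
  have hgen (T : Set β) (W : Subgroup H) (hW : ∀ p : ι, p.1.2 ∈ T →
      (∃ x ∈ Subgroup.closure (of '' T), (x : FreeGroup β ⧸ H) = p.1.1) → b p ∈ W) :
      (Subgroup.closure (of '' T)).subgroupOf H ≤ W := by
    intro h hh
    have := mem_of_schreier_generators_mem ht1 (W.map H.subtype) (S := T) (fun a ha x hx => ?_)
      (Subgroup.mem_subgroupOf.1 hh) h.2
    · obtain ⟨y, hy, hyh⟩ := this
      rwa [← Subtype.ext hyh]
    · by_cases hT : t (of a • (x : FreeGroup β ⧸ H)) = of a * t x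
      · rw [hT, mul_assoc, inv_mul_cancel]
        exact one_mem _
      · exact ⟨b ⟨(x, a), hT⟩, hW ⟨(x, a), hT⟩ ha ⟨x, hx, rfl⟩, rfl⟩
  have htop : Subgroup.closure (Set.range b) = ⊤ := by
    rw [eq_top_iff]
    refine le_trans ?_ (hgen Set.univ _ fun p _ _ => Subgroup.subset_closure ⟨p, rfl⟩)
    rw [Set.image_univ, closure_range_of, Subgroup.top_subgroupOf]
  have hlift {K : Type u} [Group K] (f : ι → K) : ∃! F : H →* K, ∀ p, F (b p) = f p := by
    let f' : FreeGroup β ⧸ H → β → K := fun q a =>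
      if h : t (of a • q) ≠ of a * t q then f ⟨(q, a), h⟩ else 1
    have htriv : ∀ q, edgeAction H f' (t q) ((1 : FreeGroup β), 1) = (q, 1) := by
      refine htree _ (by simp [ht1]) fun q a hqa => ?_
      rw [hqa, _root_.map_mul, Equiv.Perm.mul_apply,
        ← (edgeAction H f' (of a)).injective.eq_iff, edgeAction_of H f' a (q, 1)]
      simp [f', hqa]
    have hlab (p : ι) : edgeHom H f' (b p) = f p := by
      change (edgeAction H f' ((t (of p.1.2 • p.1.1))⁻¹ * of p.1.2 * t p.1.1) _).2 = _
      have : edgeAction H f' ((t (of p.1.2 • p.1.1))⁻¹ * of p.1.2 * t p.1.1)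
          (((1 : FreeGroup β) : FreeGroup β ⧸ H), 1) =
            (((1 : FreeGroup β) : FreeGroup β ⧸ H), f p) := by
        rw [_root_.map_mul, _root_.map_mul, Equiv.Perm.mul_apply, Equiv.Perm.mul_apply, htriv,
          _root_.map_inv, Equiv.Perm.inv_eq_iff_eq, edgeAction_of, edgeAction_apply]
        have h2 := htriv (of p.1.2 • p.1.1)
        have h3 := edgeAction_apply H f' (t (of p.1.2 • p.1.1)) (1 : FreeGroup β) 1
        rw [h2] at h3 ⊢
        have h4 : t (of p.1.2 • p.1.1) • ((1 : FreeGroup β) : FreeGroup β ⧸ H) =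
            of p.1.2 • p.1.1 := (congrArg Prod.fst h3).symm
        rw [h4]
        simp [f', p.2]
      rw [this]
    refine ⟨edgeHom H f', hlab, fun F hF => ?_⟩
    refine MonoidHom.eq_of_eqOn_dense htop ?_
    rintro _ ⟨p, rfl⟩
    rw [hF]
    exact (hlab p).symm
  refine ⟨ι, FreeGroupBasis.ofUniqueLift ι b hlift, {p | p.1.2 ∈ S ∧
    ∃ x ∈ Subgroup.closure (of '' S), (x : FreeGroup β ⧸ H) = p.1.1}, ?_⟩
  have hb (p : ι) : FreeGroupBasis.ofUniqueLift ι b hlift p = b p :=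
    lift_apply_of
  apply le_antisymm
  · rw [Subgroup.closure_le]
    rintro _ ⟨⟨⟨q, a⟩, hp⟩, ⟨ha, x, hx, rfl⟩, rfl⟩
    rw [hb]
    have ha' : of a ∈ Subgroup.closure (of '' S) := Subgroup.subset_closure ⟨a, ha, rfl⟩
    refine Subgroup.mem_subgroupOf.2 (mul_mem (mul_mem (inv_mem ?_) ha') (htS x hx))
    exact htS _ (mul_mem ha' hx)
  · exact hgen S _ fun p hp hx => Subgroup.subset_closure ⟨p, ⟨hp, hx⟩, hb p⟩

lemma FreeGroupBasis.closure_range_eq_top {ι G : Type*} [Group G] (b : FreeGroupBasis ι G) :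
    Subgroup.closure (Set.range b) = ⊤ := by
  have h : Set.range b = b.repr.symm.toMonoidHom '' Set.range of := by
    rw [← Set.range_comp]
    rfl
  rw [h, ← MonoidHom.map_closure, closure_range_of]
  exact Subgroup.map_top_of_surjective _ b.repr.symm.surjective

/-- The extension of a homomorphism of free groups by the identity on additional generators. -/
def FreeGroup.sumExtend {κ κ' : Type*} (ρ : Type*) (f : FreeGroup κ →* FreeGroup κ') :
    FreeGroup (κ ⊕ ρ) →* FreeGroup (κ' ⊕ ρ) :=
  lift (Sum.elim (fun k => map Sum.inl (f (of k))) fun r => of (Sum.inr r))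

lemma FreeGroup.sumExtend_map_inl {κ κ' : Type*} (ρ : Type*) (f : FreeGroup κ →* FreeGroup κ')
    (x : FreeGroup κ) : sumExtend ρ f (map Sum.inl x) = map Sum.inl (f x) := by
  suffices (sumExtend ρ f).comp (map Sum.inl) = (map Sum.inl).comp f from DFunLike.congr_fun this x
  ext k
  simp [sumExtend]

lemma FreeGroup.sumExtend_comp_of_comp_eq_id {κ κ' : Type*} (ρ : Type*)
    {f : FreeGroup κ →* FreeGroup κ'} {g : FreeGroup κ' →* FreeGroup κ}
    (h : g.comp f = MonoidHom.id _) :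
    (sumExtend ρ g).comp (sumExtend ρ f) = MonoidHom.id _ := by
  ext k
  rcases k with k | r
  · have hk : g (f (of k)) = of k := DFunLike.congr_fun h (of k)
    change sumExtend ρ g (sumExtend ρ f (of (Sum.inl k))) = of (Sum.inl k)
    rw [← map.of, sumExtend_map_inl, sumExtend_map_inl, hk]
  · simp [sumExtend]

/-- The extension of an isomorphism of free groups by the identity on additional generators. -/
def FreeGroup.sumExtendEquiv {κ κ' : Type*} (ρ : Type*) (e : FreeGroup κ ≃* FreeGroup κ') :
    FreeGroup (κ ⊕ ρ) ≃* FreeGroup (κ' ⊕ ρ) :=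
  MonoidHom.toMulEquiv (sumExtend ρ e.toMonoidHom) (sumExtend ρ e.symm.toMonoidHom)
    (sumExtend_comp_of_comp_eq_id ρ (by ext; simp)) (sumExtend_comp_of_comp_eq_id ρ (by ext; simp))

lemma FreeGroup.sumExtendEquiv_map_inl {κ κ' : Type*} (ρ : Type*)
    (e : FreeGroup κ ≃* FreeGroup κ') (x : FreeGroup κ) :
    sumExtendEquiv ρ e (map Sum.inl x) = map Sum.inl (e x) :=
  sumExtend_map_inl ρ e.toMonoidHom x

lemma exists_mulAut_inverting_of_mulEquiv {G G' : Type*} [Group G] [Group G'] (e : G ≃* G') {g : G}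
    (h : ∃ σ : G ≃* G, σ g = g⁻¹) : ∃ σ : G' ≃* G', σ (e g) = (e g)⁻¹ := by
  obtain ⟨σ, hσ⟩ := h
  exact ⟨(e.symm.trans σ).trans e, by simp [hσ]⟩

lemma exists_mulAut_inverting_iff_of_mulEquiv {G G' : Type*} [Group G] [Group G'] (e : G ≃* G')
    {g : G} : (∃ σ : G ≃* G, σ g = g⁻¹) ↔ ∃ σ : G' ≃* G', σ (e g) = (e g)⁻¹ :=
  ⟨exists_mulAut_inverting_of_mulEquiv e, fun h => by
    simpa using exists_mulAut_inverting_of_mulEquiv e.symm h⟩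

/-- If `v` lies in no proper standard factor with respect to any basis, every automorphism of a
larger free group inverting `v` preserves the free factor in which `v` lives. -/
lemma FreeGroup.exists_map_inl_eq_of_inverting {κ ρ : Type u} {v : FreeGroup κ}
    (hv : ∀ (ι : Type u) (b : FreeGroupBasis ι (FreeGroup κ)) (J : Set ι),
      v ∈ Subgroup.closure (b '' J) → J = Set.univ)
    (τ : FreeGroup (κ ⊕ ρ) ≃* FreeGroup (κ ⊕ ρ))
    (hτ : τ (map Sum.inl v) = (map Sum.inl v)⁻¹) (x : FreeGroup κ) :
    ∃ y : FreeGroup κ, map Sum.inl y = τ (map Sum.inl x) := by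
  let j : FreeGroup κ →* FreeGroup (κ ⊕ ρ) := τ.toMonoidHom.comp (map Sum.inl)
  have hj : Function.Injective j := τ.injective.comp (map_injective Sum.inl_injective)
  let e : FreeGroup κ ≃* j.range := MonoidHom.ofInjective hj
  obtain ⟨ι, b, J, hJ⟩ := exists_basis_closure_eq_subgroupOf j.range (Set.range Sum.inl)
  rw [← range_map] at hJ
  have hmem : e v ∈ Subgroup.closure (b '' J) := by
    rw [hJ, Subgroup.mem_subgroupOf]
    exact ⟨v⁻¹, by rw [_root_.map_inv, ← hτ]; rfl⟩
  have huniv : J = Set.univ := by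
    refine hv ι (b.map e.symm) J ?_
    have h := Subgroup.mem_map_of_mem e.symm.toMonoidHom hmem
    rw [MonoidHom.map_closure, ← Set.image_comp] at h
    exact (e.symm_apply_apply v) ▸ h
  rw [huniv, Set.image_univ, b.closure_range_eq_top] at hJ
  have h : e x ∈ (map Sum.inl).range.subgroupOf j.range := hJ ▸ Subgroup.mem_top _
  exact Subgroup.mem_subgroupOf.1 h

lemma FreeGroup.exists_inverting_of_minimal {κ ρ : Type u} {v : FreeGroup κ}
    (hv : ∀ (ι : Type u) (b : FreeGroupBasis ι (FreeGroup κ)) (J : Set ι),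
      v ∈ Subgroup.closure (b '' J) → J = Set.univ)
    (τ : FreeGroup (κ ⊕ ρ) ≃* FreeGroup (κ ⊕ ρ))
    (hτ : τ (map Sum.inl v) = (map Sum.inl v)⁻¹) :
    ∃ σ : FreeGroup κ ≃* FreeGroup κ, σ v = v⁻¹ := by
  have hτ' : τ.symm (map Sum.inl v) = (map Sum.inl v)⁻¹ := by
    rw [MulEquiv.symm_apply_eq, _root_.map_inv, hτ, inv_inv]
  have hinj : Function.Injective (map (Sum.inl : κ → κ ⊕ ρ)) := map_injective Sum.inl_injective
  choose s hs using exists_map_inl_eq_of_inverting hv τ hτ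
  choose s' hs' using exists_map_inl_eq_of_inverting hv τ.symm hτ'
  refine ⟨{ toFun := s
            invFun := s'
            left_inv := fun x => hinj (by rw [hs', hs, MulEquiv.symm_apply_apply])
            right_inv := fun x => hinj (by rw [hs, hs', MulEquiv.apply_symm_apply])
            map_mul' := fun x y => hinj (by simp [hs]) }, hinj ?_⟩
  change map Sum.inl (s v) = _
  rw [hs, hτ, _root_.map_inv]

theorem FreeGroup.exists_inverting_of_sum {κ ρ : Type u} [Finite κ] {v : FreeGroup κ}
    (h : ∃ τ : FreeGroup (κ ⊕ ρ) ≃* FreeGroup (κ ⊕ ρ),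
      τ (map Sum.inl v) = (map Sum.inl v)⁻¹) :
    ∃ σ : FreeGroup κ ≃* FreeGroup κ, σ v = v⁻¹ := by
  classical
  induction hn : Nat.card κ using Nat.strong_induction_on generalizing κ ρ with
  | _ n ih =>
  subst hn
  by_cases hv : ∀ (ι : Type u) (b : FreeGroupBasis ι (FreeGroup κ)) (J : Set ι),
      v ∈ Subgroup.closure (b '' J) → J = Set.univ
  · obtain ⟨τ, hτ⟩ := h
    exact exists_inverting_of_minimal hv τ hτ
  push Not at hv
  obtain ⟨ι, b, J, hvJ, hJ⟩ := hv
  have eι : κ ≃ ι := Equiv.ofFreeGroupEquiv b.repr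
  have : Finite ι := Finite.of_equiv κ eι
  have hcard : Nat.card J < Nat.card κ := by
    rw [Nat.card_congr eι]
    exact Set.ncard_lt_card hJ
  let e : FreeGroup (J ⊕ (Jᶜ : Set ι)) ≃* FreeGroup κ :=
    (freeGroupCongr (Equiv.Set.sumCompl J)).trans b.repr.symm
  obtain ⟨v', rfl⟩ : ∃ v', e (map Sum.inl v') = v := by
    have hle : Subgroup.closure (b '' J) ≤ (e.toMonoidHom.comp (map Sum.inl)).range := by
      rw [Subgroup.closure_le]
      rintro _ ⟨i, hi, rfl⟩
      exact ⟨of ⟨i, hi⟩, rfl⟩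
    exact hle hvJ
  let E : FreeGroup (J ⊕ ((Jᶜ : Set ι) ⊕ ρ)) ≃* FreeGroup (κ ⊕ ρ) :=
    (freeGroupCongr (Equiv.sumAssoc _ _ _).symm).trans (sumExtendEquiv ρ e)
  have hE (x : FreeGroup J) : E (map Sum.inl x) = map Sum.inl (e (map Sum.inl x)) := by
    rw [← sumExtendEquiv_map_inl, map.comp]
    change sumExtendEquiv ρ e (map _ (map _ _)) = _
    rw [map.comp]
    rfl
  rw [← hE, ← exists_mulAut_inverting_iff_of_mulEquiv] at h
  obtain ⟨σ, hσ⟩ := ih _ hcard h rfl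
  exact exists_mulAut_inverting_of_mulEquiv e
    ⟨sumExtendEquiv _ σ, by rw [sumExtendEquiv_map_inl, hσ, _root_.map_inv]⟩

end FreeFactor

theorem aut_inverting_incl_iff {m n : ℕ} (h : m ≤ n) (w : FreeGroup (Fin m)) :
    (∃ σ : FreeGroup (Fin m) ≃* FreeGroup (Fin m), σ w = w⁻¹) ↔
      ∃ τ : FreeGroup (Fin n) ≃* FreeGroup (Fin n),
        τ (freeIncl h w) = (freeIncl h w)⁻¹ := by
  let e : FreeGroup (Fin m ⊕ Fin (n - m)) ≃* FreeGroup (Fin n) :=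
    FreeGroup.freeGroupCongr (finSumFinEquiv.trans (finCongr (Nat.add_sub_cancel' h)))
  have he : e (FreeGroup.map Sum.inl w) = freeIncl h w := by
    suffices e.toMonoidHom.comp (FreeGroup.map Sum.inl) = freeIncl h from
      DFunLike.congr_fun this w
    ext i
    simp only [freeIncl, FreeGroup.lift_apply_of]
    rfl
  rw [← he, ← exists_mulAut_inverting_iff_of_mulEquiv]
  refine ⟨fun ⟨σ, hσ⟩ => ?_, FreeGroup.exists_inverting_of_sum⟩
  exact ⟨FreeGroup.sumExtendEquiv _ σ, by
    rw [FreeGroup.sumExtendEquiv_map_inl, hσ, map_inv]⟩
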